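/- arXiv:2310.16608 — 7 statements merged into one kernel-verified Lean document; each statement's English description precedes it below -/
import Mathlib

section
/- Suppose the distribution map D is ε-sensitive (in Kantorovich–Rubinstein dual form) and the loss ℓ is β-smooth in z, for constants ε ≥ 0 and β ≥ 0. Then for all θ, φ, θ' ∈ Θ, the mean gradients satisfy ‖∫ ∇ℓ(θ'; z) dD(θ)(z) − ∫ ∇ℓ(θ'; z) dD(φ)(z)‖ ≤ ε β ‖θ − φ‖. -/
open MeasureTheory

/-- If the distribution map `D` is `ε`-sensitive (Kantorovich–Rubinstein dual form)
and the loss is `β`-smooth in `z`, then the mean gradients on `D θ` and `D φ`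
differ by at most `ε * β * ‖θ - φ‖`. -/
theorem mean_gradient_shift_bound
    {d : ℕ} {Z : Type*} [NormedAddCommGroup Z] [NormedSpace ℝ Z]
    [FiniteDimensional ℝ Z] [MeasurableSpace Z] [BorelSpace Z]
    (Θ : Set (EuclideanSpace ℝ (Fin d)))
    (hΘclosed : IsClosed Θ) (hΘconvex : Convex ℝ Θ) (hΘne : Θ.Nonempty)
    (D : EuclideanSpace ℝ (Fin d) → Measure Z)
    (hDprob : ∀ θ ∈ Θ, IsProbabilityMeasure (D θ))
    (gradℓ : EuclideanSpace ℝ (Fin d) → Z → EuclideanSpace ℝ (Fin d))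
    (ε β : ℝ) (hε : 0 ≤ ε) (hβ : 0 ≤ β)
    -- ε-sensitivity in Kantorovich–Rubinstein dual form
    (hsens : ∀ φ : Z → ℝ, (∀ z z' : Z, |φ z - φ z'| ≤ ‖z - z'‖) →
      ∀ θ ∈ Θ, ∀ θ' ∈ Θ, |∫ z, φ z ∂(D θ) - ∫ z, φ z ∂(D θ')| ≤ ε * ‖θ - θ'‖)
    -- β-smoothness of the loss in z
    (hsmooth : ∀ θ ∈ Θ, ∀ z z' : Z, ‖gradℓ θ z - gradℓ θ z'‖ ≤ β * ‖z - z'‖)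
    -- integrability of the gradient
    (hint : ∀ θ ∈ Θ, ∀ θ' ∈ Θ, Integrable (gradℓ θ') (D θ)) :
    ∀ θ ∈ Θ, ∀ φ ∈ Θ, ∀ θ' ∈ Θ,
      ‖(∫ z, gradℓ θ' z ∂(D θ)) - ∫ z, gradℓ θ' z ∂(D φ)‖ ≤ ε * β * ‖θ - φ‖ := by
  intro θ hθ φ hφ θ' hθ'
  have := hDprob θ hθ
  have := hDprob φ hφ
  set v := (∫ z, gradℓ θ' z ∂(D θ)) - ∫ z, gradℓ θ' z ∂(D φ) with hv
  have hrhs : 0 ≤ ε * β * ‖θ - φ‖ := by positivity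
  rcases hβ.eq_or_lt with hb | hb
  · have hc : ∀ z, gradℓ θ' z = gradℓ θ' 0 := by
      intro z
      have h := hsmooth θ' hθ' z 0
      rw [← hb, zero_mul] at h
      exact sub_eq_zero.mp (norm_le_zero_iff.mp h)
    have h0 : v = 0 := by
      rw [hv]
      simp only [hc]
      simp
    rw [h0, norm_zero]
    exact hrhs
  rcases (norm_nonneg v).eq_or_lt with h0 | h0
  · rw [← h0]
    exact hrhs
  have hp : 0 < β * ‖v‖ := mul_pos hb h0
  have key := hsens (fun z => (β * ‖v‖)⁻¹ * inner ℝ v (gradℓ θ' z)) (by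
    intro z z'
    rw [← mul_sub, ← inner_sub_right, abs_mul, abs_of_pos (inv_pos.mpr hp),
      inv_mul_le_iff₀ hp]
    calc |inner ℝ v (gradℓ θ' z - gradℓ θ' z')|
        ≤ ‖v‖ * ‖gradℓ θ' z - gradℓ θ' z'‖ := abs_real_inner_le_norm _ _
      _ ≤ ‖v‖ * (β * ‖z - z'‖) := by
          gcongr
          exact hsmooth θ' hθ' z z'
      _ = β * ‖v‖ * ‖z - z'‖ := by ring) θ hθ φ hφ
  rw [integral_const_mul, integral_const_mul, integral_inner (hint θ hθ θ' hθ'),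
    integral_inner (hint φ hφ θ' hθ'), ← mul_sub, ← inner_sub_right, ← hv,
    real_inner_self_eq_norm_sq, abs_of_nonneg (by positivity), inv_mul_le_iff₀ hp] at key
  have : ‖v‖ * ‖v‖ ≤ ‖v‖ * (ε * β * ‖θ - φ‖) := by linarith
  exact le_of_mul_le_mul_left this h0
end

section
/- Suppose the loss ℓ is γ-strongly convex in θ (γ > 0) and β-smooth in z (β ≥ 0), and the distribution map D is ε-sensitive (in Kantorovich–Rubinstein dual form, ε ≥ 0). Assume that for every θ ∈ Θ the risk Risk(·, D(θ)) attains a minimizer on Θ, and let G(θ) denote this (unique) minimizer. Then the retraining map G : Θ → Θ is (εβ/γ)-Lipschitz: for all θ, φ ∈ Θ, ‖G(θ) − G(φ)‖ ≤ (εβ/γ)‖θ − φ‖. -/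
open MeasureTheory

lemma aux_lim (c Δ : ℝ) (hΔ : 0 ≤ Δ) (h : ∀ t : ℝ, 0 < t → t < 1 → (1 - t) * c ≤ Δ) : c ≤ Δ := by
  by_contra hc
  push Not at hc
  have hc0 : 0 < c := lt_of_le_of_lt hΔ hc
  have h1 := h ((c - Δ) / (2 * c)) (by apply div_pos <;> linarith)
    (by rw [div_lt_one (by linarith)]; linarith)
  have h2 : (1 - (c - Δ) / (2 * c)) * c = c - (c - Δ) / 2 := by field_simp
  linarith

lemma aux_norm {E : Type*} [NormedAddCommGroup E] [InnerProductSpace ℝ E] (a b : E) (t : ℝ) :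
    ‖(1 - t) • a + t • b‖ ^ 2 = (1 - t) * ‖a‖ ^ 2 + t * ‖b‖ ^ 2 - t * (1 - t) * ‖a - b‖ ^ 2 := by
  rw [norm_add_sq_real, norm_sub_sq_real, norm_smul, norm_smul, inner_smul_left, inner_smul_right,
    mul_pow, mul_pow]
  simp only [Real.norm_eq_abs, sq_abs, conj_trivial]
  ring

lemma aux_min {E Z : Type*} [NormedAddCommGroup E] [InnerProductSpace ℝ E] [MeasurableSpace Z]
    (Θ : Set E) (hΘ : Convex ℝ Θ) (μ : Measure Z) [IsProbabilityMeasure μ] (ℓ : E → Z → ℝ) (γ : ℝ)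
    (hsc : ∀ z : Z, ConvexOn ℝ Θ (fun θ => ℓ θ z - γ / 2 * ‖θ‖ ^ 2))
    (hint : ∀ θ ∈ Θ, Integrable (fun z => ℓ θ z) μ) (a b : E) (ha : a ∈ Θ) (hb : b ∈ Θ)
    (hmin : ∀ θ ∈ Θ, ∫ z, ℓ a z ∂μ ≤ ∫ z, ℓ θ z ∂μ) :
    γ / 2 * ‖a - b‖ ^ 2 ≤ ∫ z, ℓ b z ∂μ - ∫ z, ℓ a z ∂μ := by
  apply aux_lim _ _ (sub_nonneg.2 (hmin b hb))
  intro t ht0 ht1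
  have hm : (1 - t) • a + t • b ∈ Θ := hΘ ha hb (by linarith) ht0.le (by ring)
  have h1 : ∫ z, ℓ ((1 - t) • a + t • b) z ∂μ ≤
      ∫ z, ((1 - t) * ℓ a z + t * ℓ b z - γ / 2 * (t * (1 - t) * ‖a - b‖ ^ 2)) ∂μ := by
    apply integral_mono (hint _ hm)
    · exact (((hint a ha).const_mul _).add ((hint b hb).const_mul _)).sub (integrable_const _)
    · intro z
      have h := (hsc z).2 ha hb (by linarith : 0 ≤ 1 - t) ht0.le (by ring)
      simp only [smul_eq_mul] at h
      rw [aux_norm] at h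
      simp only
      linarith
  have hi : Integrable (fun z => (1 - t) * ℓ a z + t * ℓ b z) μ :=
    ((hint a ha).const_mul _).add ((hint b hb).const_mul _)
  rw [integral_sub hi (integrable_const _),
    integral_add ((hint a ha).const_mul _) ((hint b hb).const_mul _), integral_const_mul,
    integral_const_mul, integral_const] at h1
  simp only [probReal_univ, smul_eq_mul, one_mul] at h1
  have h2 := hmin _ hm
  have h3 : t * ((1 - t) * (γ / 2 * ‖a - b‖ ^ 2)) ≤ t * (∫ z, ℓ b z ∂μ - ∫ z, ℓ a z ∂μ) := by
    linarith
  exact le_of_mul_le_mul_left h3 ht0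

/-- Under `γ`-strong convexity of the loss in `θ`, `β`-smoothness in `z`, and
`ε`-sensitivity of the distribution map, the retraining map `G` (mapping `θ`
to the minimizer of the risk on `D θ`) is `(ε β / γ)`-Lipschitz. -/
theorem retraining_map_lipschitz
    {d : ℕ} {Z : Type*} [NormedAddCommGroup Z] [NormedSpace ℝ Z]
    [FiniteDimensional ℝ Z] [MeasurableSpace Z] [BorelSpace Z]
    (Θ : Set (EuclideanSpace ℝ (Fin d)))
    (hΘclosed : IsClosed Θ) (hΘconvex : Convex ℝ Θ) (hΘne : Θ.Nonempty)
    (D : EuclideanSpace ℝ (Fin d) → Measure Z)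
    (hDprob : ∀ θ ∈ Θ, IsProbabilityMeasure (D θ))
    (ℓ : EuclideanSpace ℝ (Fin d) → Z → ℝ)
    (gradℓ : EuclideanSpace ℝ (Fin d) → Z → EuclideanSpace ℝ (Fin d))
    (hgrad : ∀ (z : Z) (θ : EuclideanSpace ℝ (Fin d)),
      HasGradientAt (fun θ' => ℓ θ' z) (gradℓ θ z) θ)
    (ε β γ : ℝ) (hε : 0 ≤ ε) (hβ : 0 ≤ β) (hγ : 0 < γ)
    -- γ-strong convexity of the loss in θ
    (hsc : ∀ z : Z, ConvexOn ℝ Θ (fun θ => ℓ θ z - γ / 2 * ‖θ‖ ^ 2))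
    -- β-smoothness of the loss in z
    (hsmooth : ∀ θ ∈ Θ, ∀ z z' : Z, ‖gradℓ θ z - gradℓ θ z'‖ ≤ β * ‖z - z'‖)
    -- ε-sensitivity in Kantorovich–Rubinstein dual form
    (hsens : ∀ φ : Z → ℝ, (∀ z z' : Z, |φ z - φ z'| ≤ ‖z - z'‖) →
      ∀ θ ∈ Θ, ∀ θ' ∈ Θ, |∫ z, φ z ∂(D θ) - ∫ z, φ z ∂(D θ')| ≤ ε * ‖θ - θ'‖)
    -- integrability of the loss and its gradient
    (hintℓ : ∀ θ ∈ Θ, ∀ θ' ∈ Θ, Integrable (fun z => ℓ θ' z) (D θ))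
    (hintg : ∀ θ ∈ Θ, ∀ θ' ∈ Θ, Integrable (gradℓ θ') (D θ))
    -- G θ is the minimizer over Θ of the risk on D θ
    (G : EuclideanSpace ℝ (Fin d) → EuclideanSpace ℝ (Fin d))
    (hGmem : ∀ θ ∈ Θ, G θ ∈ Θ)
    (hGmin : ∀ θ ∈ Θ, ∀ θ' ∈ Θ,
      (∫ z, ℓ (G θ) z ∂(D θ)) ≤ ∫ z, ℓ θ' z ∂(D θ)) :
    ∀ θ ∈ Θ, ∀ φ ∈ Θ, ‖G θ - G φ‖ ≤ ε * β / γ * ‖θ - φ‖ := by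
  intro θ hθ φ hφ
  haveI := hDprob θ hθ
  haveI := hDprob φ hφ
  have ha := hGmem θ hθ
  have hb := hGmem φ hφ
  have h1 := aux_min Θ hΘconvex (D θ) ℓ γ hsc (hintℓ θ hθ) _ _ ha hb (hGmin θ hθ)
  have h2 := aux_min Θ hΘconvex (D φ) ℓ γ hsc (hintℓ φ hφ) _ _ hb ha (hGmin φ hφ)
  rw [norm_sub_rev (G φ)] at h2
  set a := G θ
  set b := G φ
  have hL : ∀ z z' : Z, |(ℓ b z - ℓ a z) - (ℓ b z' - ℓ a z')| ≤ β * ‖a - b‖ * ‖z - z'‖ := by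
    intro z z'
    have h := hΘconvex.norm_image_sub_le_of_norm_hasFDerivWithin_le
      (f := fun x => ℓ x z - ℓ x z') (C := β * ‖z - z'‖)
      (fun x _ => ((hgrad z x).hasFDerivAt.sub (hgrad z' x).hasFDerivAt).hasFDerivWithinAt)
      (fun x hx => by
        rw [← map_sub, LinearIsometryEquiv.norm_map]
        exact hsmooth x hx z z') ha hb
    rw [norm_sub_rev b a, Real.norm_eq_abs] at h
    calc _ = |ℓ b z - ℓ b z' - (ℓ a z - ℓ a z')| := by congr 1; ring
      _ ≤ _ := h
      _ = _ := by ring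
  have hK : |∫ z, (ℓ b z - ℓ a z) ∂(D θ) - ∫ z, (ℓ b z - ℓ a z) ∂(D φ)|
      ≤ β * ‖a - b‖ * (ε * ‖θ - φ‖) := by
    have hK0 : 0 ≤ β * ‖a - b‖ := by positivity
    generalize β * ‖a - b‖ = K at hL hK0
    rcases hK0.eq_or_lt with h0 | h0
    · subst h0
      have hc : ∀ z, ℓ b z - ℓ a z = ℓ b 0 - ℓ a 0 := by
        intro z
        have := hL z 0
        rw [zero_mul] at this
        exact sub_eq_zero.1 (abs_nonpos_iff.1 this)
      simp only [hc]
      simp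
    · have := hsens (fun z => K⁻¹ * (ℓ b z - ℓ a z)) (by
        intro z z'
        rw [← mul_sub, abs_mul, abs_of_pos (inv_pos.2 h0), inv_mul_le_iff₀ h0]
        exact hL z z') θ hθ φ hφ
      rwa [integral_const_mul, integral_const_mul, ← mul_sub, abs_mul,
        abs_of_pos (inv_pos.2 h0), inv_mul_le_iff₀ h0] at this
  rw [integral_sub (hintℓ θ hθ b hb) (hintℓ θ hθ a ha),
    integral_sub (hintℓ φ hφ b hb) (hintℓ φ hφ a ha)] at hK
  have hK' := le_trans (le_abs_self _) hK
  have h3 : ‖a - b‖ * (γ * ‖a - b‖) ≤ ‖a - b‖ * (ε * β * ‖θ - φ‖) := by nlinarith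
  rw [div_mul_eq_mul_div, le_div_iff₀ hγ]
  rcases (norm_nonneg (a - b)).eq_or_lt with h0 | h0
  · rw [← h0]
    have : 0 ≤ ε * β * ‖θ - φ‖ := by positivity
    linarith
  · have := le_of_mul_le_mul_left h3 h0
    linarith
end

section
/- Suppose the loss ℓ is γ-strongly convex in θ (γ > 0) and β-smooth in z (β > 0), the distribution map D is ε-sensitive (in Kantorovich–Rubinstein dual form) with ε < γ/β, and for every θ ∈ Θ the risk Risk(·, D(θ)) attains a minimizer on Θ; let G(θ) be this unique minimizer. Then there exists a unique performatively stable point θ_PS ∈ Θ (i.e., a unique θ_PS with θ_PS = G(θ_PS)), and the repeated risk minimization iterates defined by any θ_0 ∈ Θ and θ_{k+1} = G(θ_k) converge to θ_PS at a linear rate: for all k ≥ 1, ‖θ_k − θ_PS‖ ≤ (εβ/γ)^k ‖θ_0 − θ_PS‖. -/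
open MeasureTheory

open Filter Topology in
lemma aux_grad {E : Type*} [NormedAddCommGroup E] [InnerProductSpace ℝ E] [CompleteSpace E]
    {S : Set E} {f : E → ℝ} {γ : ℝ} (hf : StrongConvexOn S γ f) {x y g : E}
    (hx : x ∈ S) (hy : y ∈ S) (hg : HasGradientAt f g x) :
    f x + inner ℝ g (y - x) + γ / 2 * ‖y - x‖ ^ 2 ≤ f y := by
  have hd : HasDerivAt (fun s : ℝ => f (x + s • (y - x))) (inner ℝ g (y - x)) 0 := by
    have h1 : HasDerivAt (fun s : ℝ => x + s • (y - x)) (y - x) 0 := by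
      simpa using ((hasDerivAt_id (0 : ℝ)).smul_const (y - x)).const_add x
    have h2 : HasFDerivAt f (InnerProductSpace.toDual ℝ E g) (x + (0 : ℝ) • (y - x)) := by
      simpa using hg.hasFDerivAt
    simpa [Function.comp_def] using h2.comp_hasDerivAt (0 : ℝ) h1
  have ht := (hasDerivAt_iff_tendsto_slope_zero.1 hd).mono_left
    (nhdsWithin_mono (0 : ℝ) (fun s (hs : s ∈ Set.Ioi (0 : ℝ)) => (ne_of_gt hs : s ≠ 0)))
  have ht2 : Tendsto (fun s : ℝ => f y - f x - γ / 2 * (1 - s) * ‖y - x‖ ^ 2) (𝓝[>] 0)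
      (𝓝 (f y - f x - γ / 2 * (1 - 0) * ‖y - x‖ ^ 2)) := by
    apply Tendsto.mono_left _ nhdsWithin_le_nhds
    apply Continuous.tendsto
    fun_prop
  have := le_of_tendsto_of_tendsto ht ht2 (by
    filter_upwards [Ioo_mem_nhdsGT (zero_lt_one' ℝ)] with s hs
    have h := hf.2 hx hy (by linarith [hs.2] : (0 : ℝ) ≤ 1 - s) hs.1.le (by ring)
    have e : (1 - s) • x + s • y = x + s • (y - x) := by
      rw [smul_sub, sub_smul, one_smul]; abel
    rw [e, norm_sub_rev] at h
    simp only [smul_eq_mul, zero_add, zero_smul, add_zero] at h ⊢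
    rw [inv_mul_le_iff₀ hs.1]
    nlinarith [h])
  linarith

open Filter Topology in
lemma aux_growth {E : Type*} [NormedAddCommGroup E] [InnerProductSpace ℝ E]
    {S : Set E} {f : E → ℝ} {γ : ℝ} (hf : StrongConvexOn S γ f) {a x : E}
    (ha : a ∈ S) (hx : x ∈ S) (hmin : ∀ y ∈ S, f a ≤ f y) :
    f a + γ / 2 * ‖x - a‖ ^ 2 ≤ f x := by
  have ht2 : Tendsto (fun s : ℝ => f a + γ / 2 * (1 - s) * ‖x - a‖ ^ 2) (𝓝[>] 0)
      (𝓝 (f a + γ / 2 * (1 - 0) * ‖x - a‖ ^ 2)) := by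
    apply Tendsto.mono_left _ nhdsWithin_le_nhds
    apply Continuous.tendsto
    fun_prop
  have := le_of_tendsto ht2 (b := f x) (by
    filter_upwards [Ioo_mem_nhdsGT (zero_lt_one' ℝ)] with s hs
    have h1 : (0 : ℝ) ≤ 1 - s := by linarith [hs.2]
    have h := hf.2 ha hx h1 hs.1.le (by ring)
    have h2 := hmin _ (hf.1 ha hx h1 hs.1.le (by ring))
    rw [norm_sub_rev] at h
    simp only [smul_eq_mul] at h
    refine le_of_mul_le_mul_left ?_ hs.1
    nlinarith [h, h2])
  linarith


/-- **Convergence of repeated risk minimization** (Perdomo et al., 2020).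
If the loss is `γ`-strongly convex in `θ`, `β`-smooth in `z`, and the distribution
map is `ε`-sensitive with `ε < γ / β`, then there is a unique performatively stable
point and RRM converges to it at the linear rate `(ε β / γ)^k`. -/
theorem rrm_converges_to_unique_stable_point
    {d : ℕ} {Z : Type*} [NormedAddCommGroup Z] [NormedSpace ℝ Z]
    [FiniteDimensional ℝ Z] [MeasurableSpace Z] [BorelSpace Z]
    (Θ : Set (EuclideanSpace ℝ (Fin d)))
    (hΘclosed : IsClosed Θ) (hΘconvex : Convex ℝ Θ) (hΘne : Θ.Nonempty)
    (D : EuclideanSpace ℝ (Fin d) → Measure Z)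
    (hDprob : ∀ θ ∈ Θ, IsProbabilityMeasure (D θ))
    (ℓ : EuclideanSpace ℝ (Fin d) → Z → ℝ)
    (gradℓ : EuclideanSpace ℝ (Fin d) → Z → EuclideanSpace ℝ (Fin d))
    (hgrad : ∀ (z : Z) (θ : EuclideanSpace ℝ (Fin d)),
      HasGradientAt (fun θ' => ℓ θ' z) (gradℓ θ z) θ)
    (ε β γ : ℝ) (hε : 0 ≤ ε) (hβ : 0 < β) (hγ : 0 < γ) (hεsmall : ε < γ / β)
    -- γ-strong convexity of the loss in θ
    (hsc : ∀ z : Z, ConvexOn ℝ Θ (fun θ => ℓ θ z - γ / 2 * ‖θ‖ ^ 2))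
    -- β-smoothness of the loss in z
    (hsmooth : ∀ θ ∈ Θ, ∀ z z' : Z, ‖gradℓ θ z - gradℓ θ z'‖ ≤ β * ‖z - z'‖)
    -- ε-sensitivity in Kantorovich–Rubinstein dual form
    (hsens : ∀ φ : Z → ℝ, (∀ z z' : Z, |φ z - φ z'| ≤ ‖z - z'‖) →
      ∀ θ ∈ Θ, ∀ θ' ∈ Θ, |∫ z, φ z ∂(D θ) - ∫ z, φ z ∂(D θ')| ≤ ε * ‖θ - θ'‖)
    -- integrability of the loss and its gradient
    (hintℓ : ∀ θ ∈ Θ, ∀ θ' ∈ Θ, Integrable (fun z => ℓ θ' z) (D θ))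
    (hintg : ∀ θ ∈ Θ, ∀ θ' ∈ Θ, Integrable (gradℓ θ') (D θ))
    -- G θ is the minimizer over Θ of the risk on D θ
    (G : EuclideanSpace ℝ (Fin d) → EuclideanSpace ℝ (Fin d))
    (hGmem : ∀ θ ∈ Θ, G θ ∈ Θ)
    (hGmin : ∀ θ ∈ Θ, ∀ θ' ∈ Θ,
      (∫ z, ℓ (G θ) z ∂(D θ)) ≤ ∫ z, ℓ θ' z ∂(D θ)) :
    ∃ θPS ∈ Θ, G θPS = θPS ∧
      (∀ θ' ∈ Θ, G θ' = θ' → θ' = θPS) ∧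
      ∀ (θseq : ℕ → EuclideanSpace ℝ (Fin d)), θseq 0 ∈ Θ →
        (∀ k : ℕ, θseq (k + 1) = G (θseq k)) →
        ∀ k : ℕ, 1 ≤ k → ‖θseq k - θPS‖ ≤ (ε * β / γ) ^ k * ‖θseq 0 - θPS‖ := by
  have hsc' : ∀ z, StrongConvexOn Θ γ (fun θ => ℓ θ z) := fun z =>
    strongConvexOn_iff_convex.2 (hsc z)
  have hR : ∀ θ ∈ Θ, StrongConvexOn Θ γ (fun x => ∫ z, ℓ x z ∂(D θ)) := by
    intro θ hθ
    have := hDprob θ hθ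
    refine ⟨hΘconvex, ?_⟩
    intro x hx y hy a b ha hb hab
    have hm := hΘconvex hx hy ha hb hab
    have ix := hintℓ θ hθ x hx
    have iy := hintℓ θ hθ y hy
    have h := integral_mono (hintℓ θ hθ _ hm)
      (((ix.const_mul a).add (iy.const_mul b)).sub
        (integrable_const (a * b * (γ / 2 * ‖x - y‖ ^ 2))))
      (fun z => by simpa using (hsc' z).2 hx hy ha hb hab)
    simp only [Pi.add_apply, Pi.sub_apply] at h
    rw [integral_sub (f := fun z => a * ℓ x z + b * ℓ y z) ((ix.const_mul a).add (iy.const_mul b)) (integrable_const _),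
      integral_add (ix.const_mul a) (iy.const_mul b), integral_const_mul, integral_const_mul] at h
    simpa using h
  -- gradient inequality, integrated
  have hI : ∀ θ ∈ Θ, ∀ x ∈ Θ, ∀ v, Integrable (fun z => inner ℝ (gradℓ x z) v) (D θ) :=
    fun θ hθ x hx v => (hintg θ hθ x hx).inner_const v
  have hgi : ∀ θ ∈ Θ, ∀ x ∈ Θ, ∀ y ∈ Θ, (∫ z, ℓ x z ∂(D θ)) +
      (∫ z, inner ℝ (gradℓ x z) (y - x) ∂(D θ)) + γ / 2 * ‖y - x‖ ^ 2 ≤ ∫ z, ℓ y z ∂(D θ) := by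
    intro θ hθ x hx y hy
    have := hDprob θ hθ
    have ix := hintℓ θ hθ x hx
    have h := integral_mono ((ix.add (hI θ hθ x hx (y - x))).add
        (integrable_const (γ / 2 * ‖y - x‖ ^ 2))) (hintℓ θ hθ y hy)
      (fun z => aux_grad (hsc' z) hx hy (hgrad z x))
    simp only [Pi.add_apply] at h
    rw [integral_add (f := fun z => ℓ x z + inner ℝ (gradℓ x z) (y - x)) (ix.add (hI θ hθ x hx (y - x))) (integrable_const _),
      integral_add ix (hI θ hθ x hx (y - x))] at h
    simpa using h
  have hcon : ∀ θ ∈ Θ, ∀ θ' ∈ Θ, ‖G θ - G θ'‖ ≤ ε * β / γ * ‖θ - θ'‖ := by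
    intro θ hθ θ' hθ'
    obtain ⟨a, haG⟩ : ∃ a, a = G θ := ⟨_, rfl⟩
    obtain ⟨b, hbG⟩ : ∃ b, b = G θ' := ⟨_, rfl⟩
    have ha : a ∈ Θ := haG ▸ hGmem θ hθ
    have hb : b ∈ Θ := hbG ▸ hGmem θ' hθ'
    rw [← haG, ← hbG]
    obtain ⟨v, hv⟩ : ∃ v, v = (1 / 2 : ℝ) • (b - a) := ⟨_, rfl⟩
    obtain ⟨m, hmd⟩ : ∃ m, m = a + v := ⟨_, rfl⟩
    have hm : m ∈ Θ := by
      have := hΘconvex ha hb (by norm_num : (0 : ℝ) ≤ 1 / 2) (by norm_num : (0 : ℝ) ≤ 1 / 2)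
        (by norm_num)
      convert this using 1
      rw [hmd, hv]; module
    have e1 : m - a = v := by rw [hmd]; abel
    have e2 : b - m = v := by rw [hmd, hv]; module
    have e3 : a - m = -v := by rw [← e1]; abel
    have e4 : m - b = -v := by rw [← e2]; abel
    have e5 : ‖a - b‖ = 2 * ‖v‖ := by
      rw [hv, norm_smul, norm_sub_rev]; norm_num; ring
    have g1 := aux_growth (hR θ hθ) ha hm (by rw [haG]; exact hGmin θ hθ)
    have g2 := aux_growth (hR θ' hθ') hb hm (by rw [hbG]; exact hGmin θ' hθ')
    have g3 := hgi θ hθ m hm a ha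
    have g4 := hgi θ' hθ' m hm b hb
    simp only [e1, e2, e3, e4, inner_neg_right, norm_neg, integral_neg] at g1 g2 g3 g4
    by_cases hv0 : ‖v‖ = 0
    · rw [e5, hv0]; simp only [mul_zero]; positivity
    have hvp : 0 < ‖v‖ := lt_of_le_of_ne (norm_nonneg _) (Ne.symm hv0)
    have hs := hsens (fun z => (β * ‖v‖)⁻¹ * inner ℝ (gradℓ m z) v) (by
      intro z z'
      rw [← mul_sub, ← inner_sub_left, abs_mul, abs_of_pos (by positivity),
        inv_mul_le_iff₀ (by positivity)]
      calc _ ≤ ‖gradℓ m z - gradℓ m z'‖ * ‖v‖ := abs_real_inner_le_norm _ _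
        _ ≤ (β * ‖z - z'‖) * ‖v‖ := by gcongr; exact hsmooth m hm z z'
        _ = _ := by ring) θ hθ θ' hθ'
    rw [integral_const_mul, integral_const_mul, ← mul_sub, abs_mul, abs_of_pos (by positivity),
      inv_mul_le_iff₀ (by positivity)] at hs
    have hs' := (le_abs_self _).trans hs
    have key : ‖v‖ * (2 * γ * ‖v‖) ≤ ‖v‖ * (β * (ε * ‖θ - θ'‖)) := by nlinarith
    have key' := le_of_mul_le_mul_left key hvp
    rw [e5, div_mul_eq_mul_div, le_div_iff₀ hγ]
    nlinarith
  have hq0 : 0 ≤ ε * β / γ := by positivity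
  have hq1 : ε * β / γ < 1 := by
    rw [div_lt_one hγ]; exact (lt_div_iff₀ hβ).1 hεsmall
  have hmaps : Set.MapsTo G Θ Θ := fun x hx => hGmem x hx
  have hC : ContractingWith ⟨ε * β / γ, hq0⟩ (hmaps.restrict G Θ Θ) := by
    refine ⟨by exact_mod_cast hq1, LipschitzWith.of_dist_le_mul ?_⟩
    rintro ⟨x, hx⟩ ⟨y, hy⟩
    rw [Subtype.dist_eq, Subtype.dist_eq, dist_eq_norm, dist_eq_norm]
    exact hcon x hx y hy
  obtain ⟨x0, hx0⟩ := hΘne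
  obtain ⟨p, hp, hfix, -⟩ := hC.exists_fixedPoint' hΘclosed.isComplete hmaps hx0 (edist_ne_top _ _)
  have hfix' : G p = p := hfix
  refine ⟨p, hp, hfix', ?_, ?_⟩
  · intro θ' hθ' h
    have h1 := hcon θ' hθ' p hp
    rw [h, hfix'] at h1
    have : ‖θ' - p‖ = 0 := by nlinarith [norm_nonneg (θ' - p)]
    exact sub_eq_zero.1 (norm_eq_zero.1 this)
  · intro s hs0 hs k _
    have hmem : ∀ k, s k ∈ Θ := by
      intro k
      induction k with
      | zero => exact hs0
      | succ k ih => rw [hs]; exact hGmem _ ih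
    clear * - hcon hmem hs hq0 hfix' hp
    induction k with
    | zero => simp
    | succ k ih =>
      have h1 := hcon (s k) (hmem k) p hp
      rw [hfix', ← hs] at h1
      calc _ ≤ _ := h1
        _ ≤ ε * β / γ * ((ε * β / γ) ^ k * ‖s 0 - p‖) := by gcongr
        _ = _ := by ring
end

section
/- Suppose the loss is L_z-Lipschitz in the data: |ℓ(θ; z) − ℓ(θ; z')| ≤ L_z‖z − z'‖ for all θ ∈ Θ and z, z' ∈ Z, and the distribution map D is ε-sensitive (in Kantorovich–Rubinstein dual form). Then for all θ, θ' ∈ Θ, |Risk(θ', D(θ')) − Risk(θ', D(θ))| ≤ L_z ε ‖θ' − θ‖; in particular the performative risk of an unexplored model θ' admits the upper confidence bound PR(θ') ≤ Risk(θ', D(θ)) + L_z ε ‖θ' − θ‖ for every previously deployed model θ. -/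
open MeasureTheory

/-- **Performative confidence bounds.** If the loss is `L_z`-Lipschitz in the data
and the distribution map is `ε`-sensitive, then
`|PR(θ') - Risk(θ', D(θ))| ≤ L_z ε ‖θ' - θ‖`; in particular the performative risk
of an unexplored model admits the upper confidence bound
`PR(θ') ≤ Risk(θ', D(θ)) + L_z ε ‖θ' - θ‖`. -/
theorem performative_confidence_bound
    {d : ℕ} {Z : Type*} [NormedAddCommGroup Z] [NormedSpace ℝ Z]
    [FiniteDimensional ℝ Z] [MeasurableSpace Z] [BorelSpace Z]
    (Θ : Set (EuclideanSpace ℝ (Fin d)))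
    (hΘclosed : IsClosed Θ) (hΘconvex : Convex ℝ Θ) (hΘne : Θ.Nonempty)
    (D : EuclideanSpace ℝ (Fin d) → Measure Z)
    (hDprob : ∀ θ ∈ Θ, IsProbabilityMeasure (D θ))
    (ℓ : EuclideanSpace ℝ (Fin d) → Z → ℝ)
    (Lz ε : ℝ) (hLz : 0 ≤ Lz) (hε : 0 ≤ ε)
    -- L_z-Lipschitzness of the loss in the data
    (hlip : ∀ θ ∈ Θ, ∀ z z' : Z, |ℓ θ z - ℓ θ z'| ≤ Lz * ‖z - z'‖)
    -- ε-sensitivity in Kantorovich–Rubinstein dual form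
    (hsens : ∀ φ : Z → ℝ, (∀ z z' : Z, |φ z - φ z'| ≤ ‖z - z'‖) →
      ∀ θ ∈ Θ, ∀ θ' ∈ Θ, |∫ z, φ z ∂(D θ) - ∫ z, φ z ∂(D θ')| ≤ ε * ‖θ - θ'‖)
    -- integrability of the loss
    (hint : ∀ θ ∈ Θ, ∀ θ' ∈ Θ, Integrable (fun z => ℓ θ' z) (D θ)) :
    ∀ θ ∈ Θ, ∀ θ' ∈ Θ,
      |(∫ z, ℓ θ' z ∂(D θ')) - ∫ z, ℓ θ' z ∂(D θ)| ≤ Lz * ε * ‖θ' - θ‖ ∧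
      (∫ z, ℓ θ' z ∂(D θ')) ≤ (∫ z, ℓ θ' z ∂(D θ)) + Lz * ε * ‖θ' - θ‖ := by
  intro θ hθ θ' hθ'
  have key : |(∫ z, ℓ θ' z ∂(D θ')) - ∫ z, ℓ θ' z ∂(D θ)| ≤ Lz * ε * ‖θ' - θ‖ := by
    rcases hLz.eq_or_lt with h0 | hpos
    · have hc : ∀ z, ℓ θ' z = ℓ θ' 0 := by
        intro z
        have h := hlip θ' hθ' z 0
        rw [← h0, zero_mul] at h
        exact sub_eq_zero.mp (abs_nonpos_iff.mp h)
      haveI := hDprob θ hθ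
      haveI := hDprob θ' hθ'
      simp_rw [hc]
      simp [← h0]
    · have h := hsens (fun z => Lz⁻¹ * ℓ θ' z) (by
        intro z z'
        rw [← mul_sub, abs_mul, abs_of_pos (inv_pos.mpr hpos), inv_mul_le_iff₀ hpos]
        exact hlip θ' hθ' z z') θ' hθ' θ hθ
      rw [integral_const_mul, integral_const_mul, ← mul_sub, abs_mul,
        abs_of_pos (inv_pos.mpr hpos), inv_mul_le_iff₀ hpos] at h
      rw [mul_assoc]
      exact h
  exact ⟨key, by linarith [le_abs_self ((∫ z, ℓ θ' z ∂(D θ')) - ∫ z, ℓ θ' z ∂(D θ))]⟩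
end

section
/- Let U be a nonempty finite population. For each unit u ∈ U let z(u) : Ω → Z be its current data point and, for each model θ ∈ Θ, let z_θ(u) : Ω → Z be its potential-outcome data point under deployment of θ, all defined on a common probability space, with Z a metric space. Suppose the loss ℓ : Θ × Z → ℝ is L_z-Lipschitz in its second argument and all relevant compositions are integrable. Define the current risk Risk_cur(θ) = (1/|U|) Σ_{u∈U} E[ℓ(θ; z(u))], the performative risk PR(θ) = (1/|U|) Σ_{u∈U} E[ℓ(θ; z_θ(u))], and let P ≥ 0 be a bound on performative power: (1/|U|) Σ_{u∈U} E[dist(z(u), z_θ(u))] ≤ P for every θ ∈ Θ. If θ* minimizes Risk_cur over Θ and θ_PO minimizes PR over Θ, then PR(θ*) − PR(θ_PO) ≤ 2 L_z P. In particular, a firm with zero performative power gains nothing from steering: its supervised-learning solution on current data is performatively optimal. -/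
open MeasureTheory

/-- The benefit of steering is bounded by performative power: if `θ*` minimizes the
risk on current data and `θ_PO` minimizes the performative risk, then
`PR(θ*) - PR(θ_PO) ≤ 2 L_z P`, where `P` bounds the average expected displacement
of the population's data under any deployment. -/
theorem steering_gain_bounded_by_performative_power
    {U : Type*} [Fintype U] [Nonempty U]
    {Θ : Type*} [Nonempty Θ]
    {Zsp : Type*} [MetricSpace Zsp]
    {Ω : Type*} [MeasurableSpace Ω] (μ : Measure Ω) [IsProbabilityMeasure μ]
    (z : U → Ω → Zsp) (zpot : Θ → U → Ω → Zsp)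
    (ℓ : Θ → Zsp → ℝ) (Lz : ℝ) (hLz : 0 ≤ Lz)
    -- L_z-Lipschitzness of the loss in the data
    (hlip : ∀ θ : Θ, ∀ a b : Zsp, |ℓ θ a - ℓ θ b| ≤ Lz * dist a b)
    -- integrability of all relevant compositions
    (hint1 : ∀ (θ : Θ) (u : U), Integrable (fun ω => ℓ θ (z u ω)) μ)
    (hint2 : ∀ (θ θ' : Θ) (u : U), Integrable (fun ω => ℓ θ (zpot θ' u ω)) μ)
    (hint3 : ∀ (θ : Θ) (u : U), Integrable (fun ω => dist (z u ω) (zpot θ u ω)) μ)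
    -- current risk and performative risk
    (RiskCur PR : Θ → ℝ)
    (hRiskCur : ∀ θ, RiskCur θ =
      (Fintype.card U : ℝ)⁻¹ * ∑ u : U, ∫ ω, ℓ θ (z u ω) ∂μ)
    (hPR : ∀ θ, PR θ =
      (Fintype.card U : ℝ)⁻¹ * ∑ u : U, ∫ ω, ℓ θ (zpot θ u ω) ∂μ)
    -- P bounds the performative power
    (P : ℝ) (hP : 0 ≤ P)
    (hpow : ∀ θ : Θ,
      (Fintype.card U : ℝ)⁻¹ * (∑ u : U, ∫ ω, dist (z u ω) (zpot θ u ω) ∂μ) ≤ P)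
    -- θ* minimizes the current risk, θ_PO minimizes the performative risk
    (θstar θPO : Θ)
    (hθstar : ∀ θ : Θ, RiskCur θstar ≤ RiskCur θ)
    (hθPO : ∀ θ : Θ, PR θPO ≤ PR θ) :
    PR θstar - PR θPO ≤ 2 * Lz * P := by
  have hc : (0 : ℝ) ≤ (Fintype.card U : ℝ)⁻¹ := by positivity
  have key : ∀ θ : Θ, |PR θ - RiskCur θ| ≤ Lz * P := by
    intro θ
    have h1 : ∀ u : U, |∫ ω, ℓ θ (zpot θ u ω) ∂μ - ∫ ω, ℓ θ (z u ω) ∂μ|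
        ≤ Lz * ∫ ω, dist (z u ω) (zpot θ u ω) ∂μ := by
      intro u
      rw [← integral_sub (hint2 θ θ u) (hint1 θ u), ← integral_const_mul]
      refine (abs_integral_le_integral_abs).trans ?_
      refine integral_mono ((hint2 θ θ u).sub (hint1 θ u)).abs ((hint3 θ u).const_mul Lz) ?_
      intro ω
      have := hlip θ (zpot θ u ω) (z u ω)
      rw [dist_comm] at this
      exact this
    rw [hPR, hRiskCur, ← mul_sub, ← Finset.sum_sub_distrib, abs_mul, abs_of_nonneg hc]
    calc _ ≤ (Fintype.card U : ℝ)⁻¹ * ∑ u : U, Lz * ∫ ω, dist (z u ω) (zpot θ u ω) ∂μ :=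
          mul_le_mul_of_nonneg_left ((Finset.abs_sum_le_sum_abs _ _).trans
            (Finset.sum_le_sum fun u _ => h1 u)) hc
      _ = Lz * ((Fintype.card U : ℝ)⁻¹ * ∑ u : U, ∫ ω, dist (z u ω) (zpot θ u ω) ∂μ) := by
          rw [← Finset.mul_sum]; ring
      _ ≤ Lz * P := mul_le_mul_of_nonneg_left (hpow θ) hLz
  have a := abs_le.mp (key θstar)
  have b := abs_le.mp (key θPO)
  have c := hθstar θPO
  linarith [a.2, b.1]
end

section
/- Let U be a nonempty finite population of viewers. For each u ∈ U let Y_0(u), Y_1(u) : Ω → {0,1} be the potential outcome indicators that viewer u consumes the content initially in the first display slot, under no flip (T = 0) and under flipping the contents of the first and second display slots (T = 1), respectively, and let β = |(1/|U|) Σ_{u∈U} E[Y_1(u) − Y_0(u)]| be the causal effect of position. Let F be a set of actions and, for f ∈ F, let the potential outcomes z_f(u) and baseline z(u) be real-valued random variables; define performative power with respect to the metric dist(a, b) = |a − b| as P = sup_{f∈F} (1/|U|) Σ_{u∈U} E[|z(u) − z_f(u)|]. Suppose (no-interference instantiation) that z(u) = E[Y_0(u)] almost surely for every u, and that F contains an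 action f* with z_{f*}(u) = E[Y_1(u)] almost surely for every u. Then β ≤ P. -/
open MeasureTheory

/-- **Causal effect of position lower bounds performative power**
(Hardt, Jagadeesan, Mendler-Dünner, 2022). Under no interference, if the status-quo
data of each viewer is their click probability `E[Y₀(u)]` and some action realizes
the flipped arrangement, i.e. produces data `E[Y₁(u)]`, then the causal effect of
position `β` is at most the performative power `P`. -/
theorem causal_effect_of_position_le_performative_power
    {U : Type*} [Fintype U] [Nonempty U] {F : Type*}
    {Ω : Type*} [MeasurableSpace Ω] (μ : Measure Ω) [IsProbabilityMeasure μ]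
    -- potential outcome indicators for consumption of the first-slot content
    (Y0 Y1 : U → Ω → ℝ)
    (hY0bin : ∀ u ω, Y0 u ω ∈ ({0, 1} : Set ℝ))
    (hY1bin : ∀ u ω, Y1 u ω ∈ ({0, 1} : Set ℝ))
    (hY0int : ∀ u, Integrable (Y0 u) μ) (hY1int : ∀ u, Integrable (Y1 u) μ)
    -- causal effect of position
    (β : ℝ)
    (hβ : β = |(Fintype.card U : ℝ)⁻¹ *
      ∑ u : U, ((∫ ω, Y1 u ω ∂μ) - ∫ ω, Y0 u ω ∂μ)|)
    -- baseline data and potential-outcome data under actions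
    (z : U → Ω → ℝ) (zf : F → U → Ω → ℝ)
    (hint : ∀ (f : F) (u : U), Integrable (fun ω => |z u ω - zf f u ω|) μ)
    -- performative power with respect to dist(a, b) = |a - b|
    (P : ℝ)
    (hP : P = ⨆ f : F,
      (Fintype.card U : ℝ)⁻¹ * ∑ u : U, ∫ ω, |z u ω - zf f u ω| ∂μ)
    (hbdd : BddAbove (Set.range fun f : F =>
      (Fintype.card U : ℝ)⁻¹ * ∑ u : U, ∫ ω, |z u ω - zf f u ω| ∂μ))
    -- no-interference instantiation
    (hz : ∀ u : U, z u =ᵐ[μ] fun _ => ∫ ω, Y0 u ω ∂μ)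
    (hflip : ∃ fstar : F, ∀ u : U,
      zf fstar u =ᵐ[μ] fun _ => ∫ ω, Y1 u ω ∂μ) :
    β ≤ P := by
  obtain ⟨f, hf⟩ := hflip
  have key : ∀ u, ∫ ω, |z u ω - zf f u ω| ∂μ
      = |(∫ ω, Y1 u ω ∂μ) - ∫ ω, Y0 u ω ∂μ| := by
    intro u
    have h : (fun ω => |z u ω - zf f u ω|) =ᵐ[μ]
        fun _ => |(∫ ω, Y1 u ω ∂μ) - ∫ ω, Y0 u ω ∂μ| := by
      filter_upwards [hz u, hf u] with ω h0 h1
      rw [h0, h1, abs_sub_comm]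
    rw [integral_congr_ae h]
    simp
  rw [hβ, hP]
  refine le_trans ?_ (le_ciSup hbdd f)
  simp only [key]
  rw [abs_mul, abs_of_nonneg (by positivity : (0 : ℝ) ≤ (Fintype.card U : ℝ)⁻¹)]
  exact mul_le_mul_of_nonneg_left (Finset.abs_sum_le_sum_abs _ _) (by positivity)
end

section
/- Let X be a countable set of feature vectors, Y a set of labels with a distinguished target label y* ∈ Y, μ₀ a probability measure on X (with all subsets measurable), g : X → X a signal function, and α ∈ (0, 1] the fractional size of the collective. Let ν = g_{#}μ₀ be the pushforward of μ₀ under g, and let ξ = μ₀(range g) be the density of the signal set under the base distribution. Suppose the classifier f : X → Y satisfies the Bayes-optimality property on the mixture α P* + (1 − α) P₀: for every x ∈ X, if α·ν({x}) > (1 − α)·μ₀({x}) then f(x) = y*. Then the success probability of the signal-planting strategy, S(α) = ν({x : f(x) = y*}) = Pr_{x∼μ₀}[f(g(x)) = y*], satisfies S(α) ≥ 1 − ((1 − α)/α)·ξ. -/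
open scoped ENNReal

/-- **Effectiveness of the signal-planting strategy** (Hardt et al., 2023).
If the classifier is Bayes optimal on the mixture `α P* + (1 - α) P₀` (so it outputs
the target label `y*` wherever the collective's mass exceeds the base mass), then
the success probability of a collective of fractional size `α` satisfies
`S(α) ≥ 1 - ((1 - α)/α) ξ`, where `ξ` is the density of the signal set under the
base distribution. -/
theorem signal_planting_success
    {X : Type*} [Countable X] {Y : Type*} (ystar : Y)
    (μ0 : PMF X) (g : X → X)
    (α : ℝ≥0∞) (hα0 : 0 < α) (hα1 : α ≤ 1)
    -- ν is the pushforward of the base feature distribution under the signal g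
    (ν : PMF X) (hν : ν = μ0.map g)
    -- ξ is the density of the signal set under the base distribution
    (ξ : ℝ≥0∞) (hξ : ξ = μ0.toOuterMeasure (Set.range g))
    -- Bayes optimality of the classifier on the mixture α P* + (1 - α) P₀
    (f : X → Y)
    (hbayes : ∀ x : X, (1 - α) * μ0 x < α * ν x → f x = ystar) :
    1 - ((1 - α) / α) * ξ ≤ ν.toOuterMeasure {x | f x = ystar} := by
  have hαt : α ≠ ∞ := ne_top_of_le_ne_top ENNReal.one_ne_top hα1
  rw [tsub_le_iff_right, hξ, PMF.toOuterMeasure_apply, PMF.toOuterMeasure_apply,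
    ← ENNReal.tsum_mul_left, ← ENNReal.tsum_add]
  refine le_trans ν.tsum_coe.ge ?_
  refine ENNReal.tsum_le_tsum fun x => ?_
  by_cases hA : f x = ystar
  · rw [Set.indicator_of_mem (show x ∈ {x | f x = ystar} from hA)]
    exact le_self_add
  · by_cases hr : x ∈ Set.range g
    · rw [Set.indicator_of_mem hr]
      have h : α * ν x ≤ (1 - α) * μ0 x := not_lt.mp fun h => hA (hbayes x h)
      refine le_trans ?_ le_add_self
      rw [← ENNReal.mul_div_right_comm, ENNReal.le_div_iff_mul_le (Or.inl hα0.ne') (Or.inl hαt),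
        mul_comm]
      exact h
    · have h0 : ν x = 0 := by
        rw [hν, PMF.apply_eq_zero_iff, PMF.support_map]
        rintro ⟨y, -, rfl⟩
        exact hr ⟨y, rfl⟩
      rw [h0]
      exact zero_le
end
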